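/- arXiv:1910.02345 — 8 statements merged into one kernel-verified Lean document; each statement's English description precedes it below -/
import Mathlib

section
/- Let d ≥ 1, let h > 0, and let M ⊆ ℝ^d be a nonempty finite min-max closed set with |M| = m. Define the totally positive kernel density estimator f̂ : ℝ^d → ℝ by f̂(a) = (1/m) · Σ_{x ∈ M} N_h(a − x). Then f̂ is MTP₂, i.e. f̂(u)·f̂(v) ≤ f̂(u ∧ v)·f̂(u ∨ v) for all u, v ∈ ℝ^d. -/
/-- The scaled standard Gaussian kernel on ℝ^d with covariance h²·I:
`N_h(z) = (2πh²)^{-d/2} · exp(-‖z‖²/(2h²))`. -/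
noncomputable def gaussKernel (d : ℕ) (h : ℝ) (z : Fin d → ℝ) : ℝ :=
  (2 * Real.pi * h ^ 2) ^ (-(d : ℝ) / 2) * Real.exp (-(∑ i, (z i) ^ 2) / (2 * h ^ 2))

open scoped FinsetFamily

theorem sq_inf_sub_inf_add_sq_sup_sub_sup_le (u v a b : ℝ) :
    (u ⊓ v - a ⊓ b) ^ 2 + (u ⊔ v - a ⊔ b) ^ 2 ≤ (u - a) ^ 2 + (v - b) ^ 2 := by
  rcases le_total u v with huv | huv <;> rcases le_total a b with hab | hab <;>
    simp only [inf_of_le_left, inf_of_le_right, sup_of_le_left, sup_of_le_right, huv, hab] <;>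
    nlinarith [mul_nonneg (sub_nonneg.2 huv) (sub_nonneg.2 hab)]

theorem gaussKernel_nonneg (d : ℕ) (h : ℝ) (z : Fin d → ℝ) : 0 ≤ gaussKernel d h z := by
  unfold gaussKernel
  positivity

theorem gaussKernel_mul_le (d : ℕ) (h : ℝ) (u v a b : Fin d → ℝ) :
    gaussKernel d h (u - a) * gaussKernel d h (v - b) ≤
      gaussKernel d h (u ⊓ v - a ⊓ b) * gaussKernel d h (u ⊔ v - a ⊔ b) := by
  simp only [gaussKernel]
  rw [mul_mul_mul_comm, mul_mul_mul_comm _ (Real.exp _), ← Real.exp_add, ← Real.exp_add,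
    ← add_div, ← add_div, ← neg_add, ← neg_add, ← Finset.sum_add_distrib,
    ← Finset.sum_add_distrib]
  have hsum : ∑ i, ((u ⊓ v - a ⊓ b) i ^ 2 + (u ⊔ v - a ⊔ b) i ^ 2) ≤
      ∑ i, ((u - a) i ^ 2 + (v - b) i ^ 2) :=
    Finset.sum_le_sum fun i _ => sq_inf_sub_inf_add_sq_sup_sub_sup_le (u i) (v i) (a i) (b i)
  gcongr

theorem tpkde_is_MTP2 (d : ℕ) (hd : 1 ≤ d) (h : ℝ) (hh : 0 < h)
    (M : Finset (Fin d → ℝ)) (hMne : M.Nonempty)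
    (hMclosed : ∀ a ∈ M, ∀ b ∈ M, a ⊓ b ∈ M ∧ a ⊔ b ∈ M)
    (fhat : (Fin d → ℝ) → ℝ)
    (hfhat : ∀ a, fhat a = (1 / (M.card : ℝ)) * ∑ x ∈ M, gaussKernel d h (a - x)) :
    ∀ u v : Fin d → ℝ, fhat u * fhat v ≤ fhat (u ⊓ v) * fhat (u ⊔ v) := by
  classical
  intro u v
  have hinf : M ⊼ M ⊆ M := Finset.infs_subset_iff.2 fun a ha b hb => (hMclosed a ha b hb).1
  have hsup : M ⊻ M ⊆ M := Finset.sups_subset_iff.2 fun a ha b hb => (hMclosed a ha b hb).2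
  have key : (∑ x ∈ M, gaussKernel d h (u - x)) * ∑ x ∈ M, gaussKernel d h (v - x) ≤
      (∑ x ∈ M, gaussKernel d h (u ⊓ v - x)) * ∑ x ∈ M, gaussKernel d h (u ⊔ v - x) := by
    refine (four_functions_theorem (fun x => gaussKernel d h (u - x))
      (fun x => gaussKernel d h (v - x)) (fun x => gaussKernel d h (u ⊓ v - x))
      (fun x => gaussKernel d h (u ⊔ v - x)) (fun _ => gaussKernel_nonneg ..)
      (fun _ => gaussKernel_nonneg ..) (fun _ => gaussKernel_nonneg ..)
      (fun _ => gaussKernel_nonneg ..) (gaussKernel_mul_le d h u v) M M).trans ?_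
    exact mul_le_mul
      (Finset.sum_le_sum_of_subset_of_nonneg hinf fun _ _ _ => gaussKernel_nonneg ..)
      (Finset.sum_le_sum_of_subset_of_nonneg hsup fun _ _ _ => gaussKernel_nonneg ..)
      (Finset.sum_nonneg fun _ _ => gaussKernel_nonneg ..)
      (Finset.sum_nonneg fun _ _ => gaussKernel_nonneg ..)
  simp only [hfhat]
  rw [mul_mul_mul_comm, mul_mul_mul_comm _ _ _ (∑ x ∈ M, gaussKernel d h (u ⊔ v - x))]
  exact mul_le_mul_of_nonneg_left key (mul_self_nonneg _)
end

section
/- Let d ≥ 1, let h > 0, and let α : ℝ^d → ℝ be a nonnegative Lebesgue-measurable and Lebesgue-integrable function that satisfies Constraint A. Then the convolution C : ℝ^d → ℝ defined by C(a) = ∫_{ℝ^d} α(x) · N_h(a − x) dx is MTP₂, i.e. C(u)·C(v) ≤ C(u ∧ v)·C(u ∨ v) for all u, v ∈ ℝ^d. -/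
open Finset MeasureTheory

/-- The vertex of the box `[x, y]` selected by the binary string `b`. -/
def vertex {d : ℕ} (x y : Fin d → ℝ) (b : Fin d → Bool) : Fin d → ℝ :=
  fun k => if b k then y k else x k

/-- Constraint A. -/
def ConstraintA {d : ℕ} (α : (Fin d → ℝ) → ℝ) : Prop :=
  ∀ x y : Fin d → ℝ, (∀ i, x i < y i) → ∀ i j : Fin d, i ≠ j →
    ∑ b ∈ univ.filter (fun b : Fin d → Bool => b i = true ∧ b j = false),
        α (vertex x y b) * α (vertex x y (fun k => !(b k)))
      ≤ ∑ b ∈ univ.filter (fun b : Fin d → Bool => b i = true ∧ b j = true),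
        α (vertex x y b) * α (vertex x y (fun k => !(b k)))

/-- Complementation of binary strings. -/
def complEquiv (d : ℕ) : (Fin d → Bool) ≃ (Fin d → Bool) where
  toFun b k := !(b k)
  invFun b k := !(b k)
  left_inv b := by simp
  right_inv b := by simp

/-- Coordinatewise exclusive or with a fixed binary string. -/
def xorEquiv {d : ℕ} (c : Fin d → Bool) : (Fin d → Bool) ≃ (Fin d → Bool) where
  toFun b k := xor (b k) (c k)
  invFun b k := xor (b k) (c k)
  left_inv b := by simp
  right_inv b := by simp

/-- The pair of opposite vertices of the box `[x, y]` selected by `b`. -/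
def vertexPair {d : ℕ} (b : Fin d → Bool) (p : (Fin d → ℝ) × (Fin d → ℝ)) :
    (Fin d → ℝ) × (Fin d → ℝ) :=
  (vertex p.1 p.2 b, vertex p.1 p.2 (fun k => !(b k)))

theorem vertex_eq_vertex_inf_sup {d : ℕ} (x y : Fin d → ℝ) (b : Fin d → Bool) :
    vertex x y b = vertex (x ⊓ y) (x ⊔ y) (xorEquiv (fun k => decide (y k < x k)) b) := by
  funext k
  by_cases hk : y k < x k
  · cases hb : b k <;> simp [vertex, xorEquiv, hb, hk, hk.le]
  · cases hb : b k <;> simp [vertex, xorEquiv, hb, hk, not_lt.1 hk]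

theorem measurePreserving_vertexPair {d : ℕ} (b : Fin d → Bool) :
    MeasurePreserving (vertexPair b) volume volume := by
  have h1 := volume_measurePreserving_arrowProdEquivProdArrow ℝ ℝ (Fin d)
  have h2 : MeasurePreserving
      (fun (z : Fin d → ℝ × ℝ) (k : Fin d) => (if b k then Prod.swap else id) (z k))
      volume volume := by
    refine volume_preserving_pi (fun k => ?_)
    cases b k
    · simpa using MeasurePreserving.id (volume : Measure (ℝ × ℝ))
    · exact Measure.measurePreserving_swap (μ := (volume : Measure ℝ)) (ν := (volume : Measure ℝ))
  suffices hb : vertexPair b = MeasurableEquiv.arrowProdEquivProdArrow ℝ ℝ (Fin d) ∘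
      (fun z k => (if b k then Prod.swap else id) (z k)) ∘
        (MeasurableEquiv.arrowProdEquivProdArrow ℝ ℝ (Fin d)).symm by
    rw [hb]
    exact h1.comp (h2.comp h1.symm)
  funext p
  refine Prod.ext (funext fun k => ?_) (funext fun k => ?_) <;>
  cases hb : b k <;>
  simp [vertexPair, vertex, MeasurableEquiv.arrowProdEquivProdArrow,
    Equiv.arrowProdEquivProdArrow, hb]

theorem ae_forall_apply_ne (d : ℕ) :
    ∀ᵐ p : (Fin d → ℝ) × (Fin d → ℝ), ∀ k, p.1 k ≠ p.2 k := by
  refine ae_all_iff.2 fun k => ?_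
  have hm : MeasurableSet {p : (Fin d → ℝ) × (Fin d → ℝ) | p.1 k ≠ p.2 k} :=
    (measurableSet_eq_fun (by fun_prop) (by fun_prop)).compl
  refine (Measure.ae_prod_iff_ae_ae hm).2 (Filter.Eventually.of_forall fun x => ?_)
  have := Measure.pi_hyperplane (fun _ : Fin d => (volume : Measure ℝ)) k (x k)
  rw [ae_iff]
  simpa [eq_comm, volume_pi] using this

/-- A function whose sums over the vertex pairs of every box are nonnegative has nonnegative
integral. -/
theorem integral_nonneg_of_sum_vertexPair_nonneg {d : ℕ}
    {F : (Fin d → ℝ) × (Fin d → ℝ) → ℝ} (hF : Integrable F)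
    (h : ∀ x y : Fin d → ℝ, (∀ i, x i < y i) → 0 ≤ ∑ b, F (vertexPair b (x, y))) :
    0 ≤ ∫ p, F p := by
  have hcomp (b : Fin d → Bool) : Integrable (fun p => F (vertexPair b p)) :=
    (measurePreserving_vertexPair b).integrable_comp_of_integrable hF
  have hint (b : Fin d → Bool) : ∫ p, F (vertexPair b p) = ∫ p, F p := by
    have hb := measurePreserving_vertexPair b
    rw [← integral_map hb.measurable.aemeasurable (by rw [hb.map_eq]; exact hF.1), hb.map_eq]
  have hsum : 0 ≤ ∫ p, ∑ b, F (vertexPair b p) := by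
    refine integral_nonneg_of_ae ?_
    filter_upwards [ae_forall_apply_ne d] with p hp
    have := h (p.1 ⊓ p.2) (p.1 ⊔ p.2) (fun i => by simpa using (hp i).symm)
    rw [← Equiv.sum_comp (xorEquiv (fun k => decide (p.2 k < p.1 k)))] at this
    refine this.trans_eq (sum_congr rfl fun b _ => congrArg F ?_)
    unfold vertexPair
    rw [vertex_eq_vertex_inf_sup p.1 p.2 b, vertex_eq_vertex_inf_sup p.1 p.2 (fun k => !(b k))]
    congr 2
    funext k
    simp [xorEquiv]
  rw [integral_finsetSum _ fun b _ => hcomp b] at hsum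
  simp only [hint, sum_const, nsmul_eq_mul] at hsum
  exact nonneg_of_mul_nonneg_right hsum (by simp)

theorem ConstraintA.sum_vertexPair_nonneg {d : ℕ} {W : (Fin d → ℝ) → ℝ} (hW : ConstraintA W)
    {i j : Fin d} (hij : i ≠ j) {f g : ℝ → ℝ} (hf : Monotone f) (hg : Monotone g)
    {x y : Fin d → ℝ} (hxy : ∀ k, x k < y k) :
    0 ≤ ∑ b : Fin d → Bool, W (vertex x y b) * W (vertex x y (fun k => !(b k))) *
      ((f (vertex x y (fun k => !(b k)) i) - f (vertex x y b i)) *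
        g (vertex x y (fun k => !(b k)) j)) := by
  set w : (Fin d → Bool) → ℝ := fun b => W (vertex x y b) * W (vertex x y (fun k => !(b k)))
    with hw
  set t : (Fin d → Bool) → ℝ := fun b => w b *
      ((f (vertex x y (fun k => !(b k)) i) - f (vertex x y b i)) *
        g (vertex x y (fun k => !(b k)) j)) with ht
  have hsplit : ∑ b, t b = ∑ b with b i = true, (t b + t (fun k => !(b k))) := by
    rw [← sum_filter_add_sum_filter_not univ (fun b : Fin d → Bool => b i = true),
      sum_add_distrib]
    congr 1
    exact (sum_equiv (complEquiv d) (by simp [complEquiv]) (by simp [complEquiv])).symm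
  have hpair : ∀ b ∈ univ.filter (fun b : Fin d → Bool => b i = true),
      t b + t (fun k => !(b k)) =
        (f (y i) - f (x i)) * (g (y j) - g (x j)) * (if b j = true then w b else - w b) := by
    intro b hb
    have hb : b i = true := by simpa using hb
    cases hj : b j <;> simp [ht, hw, vertex, hb, hj] <;> ring
  have key : 0 ≤ ∑ b with b i = true, (if b j = true then w b else - w b) := by
    rw [← sum_filter_add_sum_filter_not _ (fun b : Fin d → Bool => b j = true), filter_filter,
      filter_filter, sum_congr rfl (g := w) (by simp +contextual),
      sum_congr (s₁ := filter (fun b : Fin d → Bool => b i = true ∧ ¬ b j = true) univ)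
        (g := fun b => - w b) rfl (by simp +contextual), sum_neg_distrib]
    have := hW x y hxy i j hij
    simp only [Bool.not_eq_true]
    linarith
  change 0 ≤ ∑ b, t b
  rw [hsplit, sum_congr rfl hpair, ← mul_sum]
  exact mul_nonneg (mul_nonneg (sub_nonneg.2 (hf (hxy i).le)) (sub_nonneg.2 (hg (hxy j).le))) key

/-- Monotone functions of two distinct coordinates are nonnegatively correlated under a density
satisfying Constraint A. -/
theorem ConstraintA.integral_mul_integral_le {d : ℕ} {W : (Fin d → ℝ) → ℝ} (hW : ConstraintA W)
    {i j : Fin d} (hij : i ≠ j) {f g : ℝ → ℝ} (hf : Monotone f) (hg : Monotone g)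
    (h0 : Integrable W) (h1 : Integrable fun x => W x * f (x i))
    (h2 : Integrable fun x => W x * g (x j))
    (h12 : Integrable fun x => W x * f (x i) * g (x j)) :
    (∫ x, W x * f (x i)) * (∫ x, W x * g (x j)) ≤
      (∫ x, W x) * ∫ x, W x * f (x i) * g (x j) := by
  have hI : Integrable fun p : (Fin d → ℝ) × (Fin d → ℝ) =>
      W p.1 * (W p.2 * f (p.2 i) * g (p.2 j)) := h0.mul_prod h12
  have hJ : Integrable fun p : (Fin d → ℝ) × (Fin d → ℝ) =>
      (W p.1 * f (p.1 i)) * (W p.2 * g (p.2 j)) := h1.mul_prod h2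
  have := integral_nonneg_of_sum_vertexPair_nonneg (hI.sub hJ) (fun x y hxy => by
    convert hW.sum_vertexPair_nonneg hij hf hg hxy using 2 with b
    simp only [vertexPair, Pi.sub_apply]
    ring)
  rw [integral_sub' hI hJ] at this
  have e1 := integral_prod_mul (μ := (volume : Measure (Fin d → ℝ))) (ν := volume) W
    (fun x => W x * f (x i) * g (x j))
  have e2 := integral_prod_mul (μ := (volume : Measure (Fin d → ℝ))) (ν := volume)
    (fun x => W x * f (x i)) (fun x => W x * g (x j))
  rw [← e1, ← e2]
  exact sub_nonneg.1 this

theorem ConstraintA.mul {d : ℕ} {α K : (Fin d → ℝ) → ℝ} (hα : ConstraintA α)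
    (hK : ∀ x, 0 ≤ K x)
    (hsymm : ∀ x y b, K (vertex x y b) * K (vertex x y (fun k => !(b k))) = K x * K y) :
    ConstraintA fun x => α x * K x := by
  intro x y hxy i j hij
  have := mul_le_mul_of_nonneg_right (hα x y hxy i j hij) (mul_nonneg (hK x) (hK y))
  have e (b : Fin d → Bool) : α (vertex x y b) * α (vertex x y (fun k => !(b k))) * (K x * K y) =
      α (vertex x y b) * K (vertex x y b) *
        (α (vertex x y (fun k => !(b k))) * K (vertex x y (fun k => !(b k)))) := by
    rw [← hsymm x y b, mul_mul_mul_comm]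
  simpa only [sum_mul, e] using this

theorem gaussKernel_pos {d : ℕ} {h : ℝ} (hh : 0 < h) (z : Fin d → ℝ) : 0 < gaussKernel d h z := by
  unfold gaussKernel
  positivity

theorem continuous_gaussKernel (d : ℕ) (h : ℝ) : Continuous (gaussKernel d h) := by
  unfold gaussKernel
  fun_prop

theorem gaussKernel_le {d : ℕ} {h : ℝ} (z : Fin d → ℝ) :
    gaussKernel d h z ≤ (2 * Real.pi * h ^ 2) ^ (-(d : ℝ) / 2) := by
  unfold gaussKernel
  refine mul_le_of_le_one_right (by positivity) (Real.exp_le_one_iff.2 ?_)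
  exact div_nonpos_of_nonpos_of_nonneg (neg_nonpos.2 (by positivity)) (by positivity)

theorem gaussKernel_vertex_mul {d : ℕ} (h : ℝ) (a x y : Fin d → ℝ) (b : Fin d → Bool) :
    gaussKernel d h (a - vertex x y b) * gaussKernel d h (a - vertex x y (fun k => !(b k))) =
      gaussKernel d h (a - x) * gaussKernel d h (a - y) := by
  have hs : ∑ k, ((a - vertex x y b) k) ^ 2 + ∑ k, ((a - vertex x y (fun k => !(b k))) k) ^ 2 =
      ∑ k, ((a - x) k) ^ 2 + ∑ k, ((a - y) k) ^ 2 := by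
    rw [← sum_add_distrib, ← sum_add_distrib]
    refine sum_congr rfl fun k _ => ?_
    cases hb : b k <;> simp [vertex, hb, add_comm]
  unfold gaussKernel
  rw [mul_mul_mul_comm, ← Real.exp_add, mul_mul_mul_comm _ _ _ (Real.exp _), ← Real.exp_add,
    ← add_div, ← add_div, ← neg_add, ← neg_add, hs]

theorem gaussKernel_add_single {d : ℕ} (h : ℝ) (z : Fin d → ℝ) (i : Fin d) (s : ℝ) :
    gaussKernel d h (z + Pi.single i s) =
      gaussKernel d h z * Real.exp (-(2 * s * z i + s ^ 2) / (2 * h ^ 2)) := by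
  have hs : ∑ k, ((z + Pi.single i s : Fin d → ℝ) k) ^ 2 = ∑ k, (z k) ^ 2 + (2 * s * z i + s ^ 2) := by
    have : ∑ k, (Pi.single i (2 * s * z i + s ^ 2) : Fin d → ℝ) k = 2 * s * z i + s ^ 2 := by
      simp
    rw [← this, ← sum_add_distrib]
    refine sum_congr rfl fun k _ => ?_
    rcases eq_or_ne k i with rfl | hk
    · simp; ring
    · simp [hk]
  unfold gaussKernel
  rw [hs, mul_assoc _ (Real.exp _) (Real.exp _), ← Real.exp_add, ← add_div, neg_add]

theorem integrable_mul_gaussKernel {d : ℕ} {h : ℝ} (hh : 0 < h) {α : (Fin d → ℝ) → ℝ}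
    (hint : Integrable α) (a : Fin d → ℝ) :
    Integrable fun x => α x * gaussKernel d h (a - x) := by
  refine hint.mul_bdd (c := (2 * Real.pi * h ^ 2) ^ (-(d : ℝ) / 2))
    ((continuous_gaussKernel d h).comp (by fun_prop)).aestronglyMeasurable
    (Filter.Eventually.of_forall fun x => ?_)
  rw [Real.norm_of_nonneg (gaussKernel_pos hh _).le]
  exact gaussKernel_le _

/-- The convolution with a Gaussian satisfies the MTP₂ inequality in any two coordinates. -/
theorem ConstraintA.conv_add_single {d : ℕ} {h : ℝ} (hh : 0 < h) {α : (Fin d → ℝ) → ℝ}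
    (hint : Integrable α) (hA : ConstraintA α) {i j : Fin d} (hij : i ≠ j) (a : Fin d → ℝ)
    {s t : ℝ} (hs : 0 ≤ s) (ht : 0 ≤ t) :
    (∫ x, α x * gaussKernel d h (a + Pi.single i s - x)) *
        (∫ x, α x * gaussKernel d h (a + Pi.single j t - x)) ≤
      (∫ x, α x * gaussKernel d h (a - x)) *
        ∫ x, α x * gaussKernel d h (a + Pi.single i s + Pi.single j t - x) := by
  obtain ⟨E, hE⟩ : ∃ E : Fin d → ℝ → ℝ → ℝ,
      ∀ k r z, E k r z = Real.exp (-(2 * r * (a k - z) + r ^ 2) / (2 * h ^ 2)) :=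
    ⟨_, fun _ _ _ => rfl⟩
  have hmono (k : Fin d) {r : ℝ} (hr : 0 ≤ r) : Monotone (E k r) := by
    intro z z' hz
    simp only [hE]
    gcongr
  have e1 (k : Fin d) (r : ℝ) (x : Fin d → ℝ) :
      α x * gaussKernel d h (a + Pi.single k r - x) =
        α x * gaussKernel d h (a - x) * E k r (x k) := by
    rw [add_sub_right_comm, gaussKernel_add_single, ← mul_assoc, Pi.sub_apply, hE]
  have e2 (x : Fin d → ℝ) : α x * gaussKernel d h (a + Pi.single i s + Pi.single j t - x) =
        α x * gaussKernel d h (a - x) * E i s (x i) * E j t (x j) := by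
    rw [add_sub_right_comm, gaussKernel_add_single, ← mul_assoc, e1 i s x]
    simp [hE, hij.symm]
  have hI := integrable_mul_gaussKernel hh hint
  have hW : ConstraintA fun x => α x * gaussKernel d h (a - x) :=
    hA.mul (K := fun x => gaussKernel d h (a - x)) (fun x => (gaussKernel_pos hh _).le) (gaussKernel_vertex_mul h a)
  have hI1 := hI (a + Pi.single i s)
  have hI2 := hI (a + Pi.single j t)
  have hI12 := hI (a + Pi.single i s + Pi.single j t)
  simp only [e1 i s] at hI1
  simp only [e1 j t] at hI2
  simp only [e2] at hI12
  simp only [e1 i s, e1 j t, e2]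
  exact hW.integral_mul_integral_le hij (hmono i hs) (hmono j ht) (hI a) hI1 hI2 hI12

/-- A function with increasing differences in any two coordinates is supermodular. -/
theorem supermodular_of_add_single {d : ℕ} {G : (Fin d → ℝ) → ℝ}
    (hG : ∀ i j : Fin d, i ≠ j → ∀ a s t, 0 ≤ s → 0 ≤ t →
      G (a + Pi.single i s) + G (a + Pi.single j t) ≤
        G a + G (a + Pi.single i s + Pi.single j t)) (u v : Fin d → ℝ) :
    G u + G v ≤ G (u ⊓ v) + G (u ⊔ v) := by
  have step (i : Fin d) (s : ℝ) (hs : 0 ≤ s) (q : Fin d → ℝ) (hq : 0 ≤ q) (hqi : q i = 0)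
      (S : Finset (Fin d)) (a : Fin d → ℝ) :
      G (a + Pi.single i s) + G (a + ∑ k ∈ S, Pi.single k (q k)) ≤
        G a + G (a + Pi.single i s + ∑ k ∈ S, Pi.single k (q k)) := by
    induction S using Finset.induction_on with
    | empty => simp [add_comm]
    | insert k S hk ih =>
      rw [sum_insert hk]
      rcases eq_or_ne k i with rfl | hki
      · simpa [hqi] using ih
      · have := hG i k hki.symm (a + ∑ k ∈ S, Pi.single k (q k)) s (q k) hs (hq k)
        have r1 : a + ∑ k ∈ S, Pi.single k (q k) + Pi.single i s =
            a + Pi.single i s + ∑ k ∈ S, Pi.single k (q k) := by abel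
        have r2 : a + (Pi.single k (q k) + ∑ k ∈ S, Pi.single k (q k)) =
            a + ∑ k ∈ S, Pi.single k (q k) + Pi.single k (q k) := by abel
        have r3 : a + Pi.single i s + (Pi.single k (q k) + ∑ k ∈ S, Pi.single k (q k)) =
            a + Pi.single i s + ∑ k ∈ S, Pi.single k (q k) + Pi.single k (q k) := by abel
        rw [r1] at this
        rw [r2, r3]
        linarith
  have main (p q : Fin d → ℝ) (hp : 0 ≤ p) (hq : 0 ≤ q) (hpq : ∀ k, p k = 0 ∨ q k = 0)
      (S : Finset (Fin d)) (a : Fin d → ℝ) :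
      G (a + ∑ k ∈ S, Pi.single k (p k)) + G (a + q) ≤
        G a + G (a + ∑ k ∈ S, Pi.single k (p k) + q) := by
    induction S using Finset.induction_on with
    | empty => simp
    | insert k S hk ih =>
      rw [sum_insert hk]
      rcases hpq k with h0 | h0
      · simpa [h0] using ih
      · have := step k (p k) (hp k) q hq h0 univ (a + ∑ k ∈ S, Pi.single k (p k))
        rw [univ_sum_single] at this
        have r1 : a + (Pi.single k (p k) + ∑ k ∈ S, Pi.single k (p k)) =
            a + ∑ k ∈ S, Pi.single k (p k) + Pi.single k (p k) := by abel
        rw [r1]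
        linarith
  have := main (u - u ⊓ v) (v - u ⊓ v) (sub_nonneg.2 inf_le_left) (sub_nonneg.2 inf_le_right)
    (fun k => by rcases le_total (u k) (v k) with h | h <;> simp [h]) univ (u ⊓ v)
  rw [univ_sum_single] at this
  have r : u ⊔ v = u ⊓ v + (u - u ⊓ v) + (v - u ⊓ v) := by
    funext k
    rcases le_total (u k) (v k) with h | h <;> simp [h]
  rw [r]
  simpa using this

theorem conv_constraintA_density_is_MTP2 (d : ℕ) (hd : 1 ≤ d) (h : ℝ) (hh : 0 < h)
    (α : (Fin d → ℝ) → ℝ) (hα : ∀ x, 0 ≤ α x)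
    (hmeas : Measurable α) (hint : Integrable α volume) (hA : ConstraintA α)
    (C : (Fin d → ℝ) → ℝ)
    (hC : ∀ a, C a = ∫ x, α x * gaussKernel d h (a - x)) :
    ∀ u v : Fin d → ℝ, C u * C v ≤ C (u ⊓ v) * C (u ⊔ v) := by
  obtain rfl : C = fun a => ∫ x, α x * gaussKernel d h (a - x) := funext hC
  intro u v
  by_cases h0 : α =ᵐ[volume] 0
  · have hz (a : Fin d → ℝ) : ∫ x, α x * gaussKernel d h (a - x) = 0 := by
      refine integral_eq_zero_of_ae ?_
      filter_upwards [h0] with x hx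
      simp [hx]
    simp [hz]
  set C : (Fin d → ℝ) → ℝ := fun a => ∫ x, α x * gaussKernel d h (a - x)
  have hpos (a : Fin d → ℝ) : 0 < C a := by
    have hnn : 0 ≤ fun x => α x * gaussKernel d h (a - x) :=
      fun x => mul_nonneg (hα x) (gaussKernel_pos hh _).le
    refine (integral_nonneg hnn).lt_of_ne' fun hzero => h0 ?_
    filter_upwards [(integral_eq_zero_iff_of_nonneg hnn
      (integrable_mul_gaussKernel hh hint a)).1 hzero] with x hx
    exact (mul_eq_zero.1 hx).resolve_right (gaussKernel_pos hh _).ne'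
  have key := supermodular_of_add_single (G := fun a => Real.log (C a))
    (fun i j hij a s t hs ht => by
      simp only [← Real.log_mul (hpos _).ne' (hpos _).ne']
      exact Real.log_le_log (mul_pos (hpos _) (hpos _)) (hA.conv_add_single hh hint hij a hs ht))
    u v
  simp only [← Real.log_mul (hpos _).ne' (hpos _).ne'] at key
  exact (Real.log_le_log_iff (mul_pos (hpos _) (hpos _)) (mul_pos (hpos _) (hpos _))).1 key
end

section
/- Let d ≥ 1, let M ⊆ ℝ^d be a min-max closed set, and let c > 0. Then the function α : ℝ^d → ℝ defined by α(x) = c if x ∈ M and α(x) = 0 otherwise satisfies Constraint A. -/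
open Finset

theorem vertex_inf {d : ℕ} {x y : Fin d → ℝ} (h : ∀ i, x i < y i) (a b : Fin d → Bool) :
    vertex x y a ⊓ vertex x y b = vertex x y (fun k => a k && b k) := by
  funext k
  have hk := (h k).le
  cases ha : a k <;> cases hb : b k <;> simp [vertex, ha, hb, hk]

theorem vertex_sup {d : ℕ} {x y : Fin d → ℝ} (h : ∀ i, x i < y i) (a b : Fin d → Bool) :
    vertex x y a ⊔ vertex x y b = vertex x y (fun k => a k || b k) := by
  funext k
  have hk := (h k).le
  cases ha : a k <;> cases hb : b k <;> simp [vertex, ha, hb, hk]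

/-- If a min-max closed set contains two pairs of opposite vertices of a box, it contains the
vertex where the two selecting strings agree. -/
theorem vertex_beq_mem {d : ℕ} {M : Set (Fin d → ℝ)}
    (hM : ∀ a ∈ M, ∀ b ∈ M, a ⊓ b ∈ M ∧ a ⊔ b ∈ M)
    {x y : Fin d → ℝ} (h : ∀ i, x i < y i) {s t : Fin d → Bool}
    (hs : vertex x y s ∈ M) (hs' : vertex x y (fun k => !(s k)) ∈ M)
    (ht : vertex x y t ∈ M) (ht' : vertex x y (fun k => !(t k)) ∈ M) :
    vertex x y (fun k => s k == t k) ∈ M := by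
  have key := (hM _ (hM _ hs _ ht).1 _ (hM _ hs' _ ht').1).2
  rw [vertex_inf h, vertex_inf h, vertex_sup h] at key
  convert key using 3 with k
  cases s k <;> cases t k <;> rfl

theorem indicator_minMaxClosed_satisfies_constraintA (d : ℕ) (hd : 1 ≤ d)
    (M : Set (Fin d → ℝ))
    (hMclosed : ∀ a ∈ M, ∀ b ∈ M, a ⊓ b ∈ M ∧ a ⊔ b ∈ M)
    (c : ℝ) (hc : 0 < c) :
    ConstraintA (M.indicator fun _ => c) := by
  classical
  intro x y h i j _
  set f : (Fin d → Bool) → ℝ := fun b =>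
    M.indicator (fun _ => c) (vertex x y b) *
      M.indicator (fun _ => c) (vertex x y (fun k => !(b k))) with hf
  have f_of_mem : ∀ b, vertex x y b ∈ M → vertex x y (fun k => !(b k)) ∈ M → f b = c * c :=
    fun b hb hb' => by simp [hf, hb, hb']
  have f_eq_zero : ∀ b, ¬(vertex x y b ∈ M ∧ vertex x y (fun k => !(b k)) ∈ M) → f b = 0 := by
    intro b hb
    rcases not_and_or.mp hb with hb | hb <;> simp [hf, hb]
  have f_nonneg : ∀ b, 0 ≤ f b := fun b =>
    mul_nonneg (Set.indicator_nonneg (fun _ _ => hc.le) _)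
      (Set.indicator_nonneg (fun _ _ => hc.le) _)
  change ∑ b ∈ _, f b ≤ ∑ b ∈ _, f b
  by_cases hex : ∃ t : Fin d → Bool, (t i = true ∧ t j = false) ∧
      vertex x y t ∈ M ∧ vertex x y (fun k => !(t k)) ∈ M
  · obtain ⟨t, ⟨hti, htj⟩, ht, ht'⟩ := hex
    calc
      _ ≤ ∑ b ∈ univ.filter (fun b : Fin d → Bool => b i = true ∧ b j = false),
          f (fun k => b k == t k) := by
        refine sum_le_sum fun b _ => ?_
        by_cases hb : vertex x y b ∈ M ∧ vertex x y (fun k => !(b k)) ∈ M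
        · rw [f_of_mem b hb.1 hb.2, f_of_mem _ (vertex_beq_mem hMclosed h hb.1 hb.2 ht ht')]
          have key := vertex_beq_mem hMclosed h (s := fun k => !(b k)) hb.2
            (by simpa using hb.1) ht ht'
          convert key using 3 with k
          cases b k <;> cases t k <;> rfl
        · rw [f_eq_zero b hb]
          exact f_nonneg _
      _ = _ := by
        refine sum_nbij' (fun b k => b k == t k) (fun b k => b k == t k) ?_ ?_ ?_ ?_ ?_
        · simp +contextual [hti, htj]
        · simp +contextual [hti, htj]
        · intro b _
          funext k
          cases hb : b k <;> cases ht : t k <;> simp [hb, ht]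
        · intro b _
          funext k
          cases hb : b k <;> cases ht : t k <;> simp [hb, ht]
        · intro b _
          rfl
  · rw [sum_eq_zero fun b hb => f_eq_zero b fun hm => hex ⟨b, (mem_filter.mp hb).2, hm⟩]
    exact sum_nonneg fun b _ => f_nonneg b
end

section
/- Let m ≥ 0 and let M be a subset of the Boolean cube {0,1}^{m+2} (functions Fin (m+2) → Bool with the coordinatewise lattice structure) that is closed under coordinatewise minimum ∧ and coordinatewise maximum ∨. For a binary string a ∈ {0,1}^m, write ā for its coordinatewise complement, and write (s, t)⌢a ∈ {0,1}^{m+2} for the string whose first coordinate is s, second coordinate is t, and remaining m coordinates are a. Then the number of a ∈ {0,1}^m such that (1,0)⌢a ∈ M and (0,1)⌢ā ∈ M is at most the number of a ∈ {0,1}^m such that (1,1)⌢a ∈ M and (0,0)⌢ā ∈ M. -/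
open Finset

theorem minMaxClosed_cube_card_ineq (m : ℕ) (M : Finset (Fin (m + 2) → Bool))
    (hMclosed : ∀ a ∈ M, ∀ b ∈ M, a ⊓ b ∈ M ∧ a ⊔ b ∈ M) :
    (univ.filter (fun a : Fin m → Bool =>
        Fin.cons true (Fin.cons false a) ∈ M ∧
        Fin.cons false (Fin.cons true (fun k => !(a k))) ∈ M)).card
      ≤ (univ.filter (fun a : Fin m → Bool =>
        Fin.cons true (Fin.cons true a) ∈ M ∧
        Fin.cons false (Fin.cons false (fun k => !(a k))) ∈ M)).card := by
  -- The Marica–Schönheim inequality: a family has at least as many differences as members.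
  refine (card_le_card_diffs _).trans ?_
  refine card_le_card_of_injOn (fun c => cᶜ) ?_ compl_injective.injOn
  intro c hc
  obtain ⟨b, hb, a, ha, rfl⟩ := mem_diffs.1 (mem_coe.1 hc)
  simp only [mem_filter, mem_univ, true_and, mem_coe] at ha hb ⊢
  constructor
  · convert (hMclosed _ ha.1 _ hb.2).2 using 1
    ext i
    refine Fin.cases ?_ (Fin.cases ?_ fun j => ?_) i
    · simp
    · simp
    · cases h : a j <;> cases h' : b j <;> simp [sdiff_eq, h, h']
  · convert (hMclosed _ hb.1 _ ha.2).1 using 1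
    ext i
    refine Fin.cases ?_ (Fin.cases ?_ fun j => ?_) i
    · simp
    · simp
    · cases h : a j <;> cases h' : b j <;> simp [sdiff_eq, h, h']
end

section
/- Let h > 0 and let a₁ > a₂, b₁ > b₂, x_i > x_k, x_j > x_l be real numbers. Define Q(u, v, s, t) = exp(−((u − s)² + (v − t)²)/(2h)). Then Q(a₁,b₁,x_i,x_j)·Q(a₂,b₂,x_k,x_l) − Q(a₁,b₂,x_i,x_j)·Q(a₂,b₁,x_k,x_l) + Q(a₁,b₁,x_k,x_l)·Q(a₂,b₂,x_i,x_j) − Q(a₁,b₂,x_k,x_l)·Q(a₂,b₁,x_i,x_j) ≥ 0. -/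
/-- The one-dimensional Gaussian kernel is totally positive of order two. -/
theorem gaussian_kernel_exchange_le {h : ℝ} (hh : 0 < h) {u₁ u₂ s₁ s₂ : ℝ}
    (hu : u₂ ≤ u₁) (hs : s₂ ≤ s₁) :
    Real.exp (-(u₁ - s₂) ^ 2 / (2 * h)) * Real.exp (-(u₂ - s₁) ^ 2 / (2 * h)) ≤
      Real.exp (-(u₁ - s₁) ^ 2 / (2 * h)) * Real.exp (-(u₂ - s₂) ^ 2 / (2 * h)) := by
  rw [← Real.exp_add, ← Real.exp_add, Real.exp_le_exp, ← add_div, ← add_div]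
  gcongr ?_ / _
  nlinarith [mul_nonneg (sub_nonneg.2 hu) (sub_nonneg.2 hs)]

theorem gaussian_exchange_nonneg (h : ℝ) (hh : 0 < h)
    (a₁ a₂ b₁ b₂ xi xk xj xl : ℝ)
    (ha : a₂ < a₁) (hb : b₂ < b₁) (hik : xk < xi) (hjl : xl < xj)
    (Q : ℝ → ℝ → ℝ → ℝ → ℝ)
    (hQ : ∀ u v s t, Q u v s t = Real.exp (-((u - s) ^ 2 + (v - t) ^ 2) / (2 * h))) :
    0 ≤ Q a₁ b₁ xi xj * Q a₂ b₂ xk xl - Q a₁ b₂ xi xj * Q a₂ b₁ xk xl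
      + Q a₁ b₁ xk xl * Q a₂ b₂ xi xj - Q a₁ b₂ xk xl * Q a₂ b₁ xi xj := by
  have hQ_mul : ∀ u v s t, Q u v s t =
      Real.exp (-(u - s) ^ 2 / (2 * h)) * Real.exp (-(v - t) ^ 2 / (2 * h)) := by
    intro u v s t
    rw [hQ, ← Real.exp_add, ← add_div, neg_add]
  have key := mul_nonneg
    (sub_nonneg.2 (gaussian_kernel_exchange_le hh ha.le hik.le))
    (sub_nonneg.2 (gaussian_kernel_exchange_le hh hb.le hjl.le))
  simp only [hQ_mul]
  linear_combination key
end

section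
/- Let φ : ℝ² → ℝ be the standard bivariate Gaussian density φ(u, v) = (1/(2π))·exp(−(u² + v²)/2), and define f̂ : ℝ² → ℝ by f̂(x, y) = (1/2)·(φ(x, y − 1) + φ(x − 1, y)), i.e. the average of two standard Gaussian bumps centered at (0,1) and (1,0). Then f̂(0,1)·f̂(1,0) > f̂(0,0)·f̂(1,1); in particular f̂ is not MTP₂ (with p₁ = (0,1), p₂ = (1,0), one has p₁ ∧ p₂ = (0,0) and p₁ ∨ p₂ = (1,1), and the MTP₂ inequality fails at this pair). -/
theorem kde_two_bumps_not_MTP2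
    (φ : ℝ → ℝ → ℝ)
    (hφ : ∀ u v, φ u v = (1 / (2 * Real.pi)) * Real.exp (-(u ^ 2 + v ^ 2) / 2))
    (fhat : ℝ × ℝ → ℝ)
    (hf : ∀ p : ℝ × ℝ, fhat p = (1 / 2) * (φ p.1 (p.2 - 1) + φ (p.1 - 1) p.2)) :
    fhat (0, 0) * fhat (1, 1) < fhat (0, 1) * fhat (1, 0) ∧
    ¬ (∀ p q : ℝ × ℝ, fhat p * fhat q ≤ fhat (p ⊓ q) * fhat (p ⊔ q)) := by
  have key : fhat (0, 0) * fhat (1, 1) < fhat (0, 1) * fhat (1, 0) := by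
    obtain ⟨c, hc⟩ : ∃ c, c = 1 / (2 * Real.pi) := ⟨_, rfl⟩
    obtain ⟨a, ha⟩ : ∃ a, a = Real.exp (-1 / 2) := ⟨_, rfl⟩
    have hc0 : 0 < c := by rw [hc]; positivity
    have ha0 : 0 < a := ha ▸ Real.exp_pos _
    have ha1 : a < 1 := ha ▸ Real.exp_lt_one_iff.2 (by norm_num)
    have hsq : Real.exp (-(1 + 1) / 2) = a ^ 2 := by
      rw [ha, ← Real.exp_nat_mul]; norm_num
    have h00 : fhat (0, 0) = c * a := by
      simp only [hf, hφ, ← hc]; rw [ha]; norm_num; ring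
    have h11 : fhat (1, 1) = c * a := by
      simp only [hf, hφ, ← hc]; rw [ha]; norm_num; ring
    have h01 : fhat (0, 1) = c * ((1 + a ^ 2) / 2) := by
      rw [← hsq]; simp only [hf, hφ, ← hc]; norm_num; ring
    have h10 : fhat (1, 0) = c * ((1 + a ^ 2) / 2) := by
      rw [← hsq]; simp only [hf, hφ, ← hc]; norm_num; ring
    have hlt : c * a < c * ((1 + a ^ 2) / 2) := by
      gcongr
      nlinarith [mul_pos (sub_pos.2 ha1) (sub_pos.2 ha1)]
    rw [h00, h11, h01, h10]
    gcongr
  refine ⟨key, fun h => key.not_ge ?_⟩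
  simpa [Prod.mk_inf_mk, Prod.mk_sup_mk] using h (0, 1) (1, 0)
end

section
/- Let K be the 2×2 matrix with rows (5, −2) and (−2, 1), and define g : ℝ² → ℝ by g(u) = exp(−(1/2)·uᵀ K u) = exp(−(1/2)·(5u₁² − 4u₁u₂ + u₂²)). Define C : ℝ² → ℝ by C(a) = g(a − (2,0)) + g(a − (0,1)) + g(a − (2,1)) + g(a − (0,0)) (the convolution of g with the uniform distribution on the min-max closed set {(2,0),(0,1),(2,1),(0,0)}, up to a positive constant). Then for p₁ = (0.98, 0.43) and p₂ = (0.49, 0.7), one has C(p₁ ∧ p₂)·C(p₁ ∨ p₂) < C(p₁)·C(p₂), where p₁ ∧ p₂ = (0.49, 0.43) and p₁ ∨ p₂ = (0.98, 0.7); in particular C is not MTP₂. -/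
theorem exp_neg_le_inv_one_add_div_pow {y : ℝ} (hy : 0 ≤ y) {n : ℕ} (hn : n ≠ 0) :
    Real.exp (-y) ≤ ((1 + y / n) ^ n)⁻¹ := by
  rw [Real.exp_neg]
  have hn' : (n : ℝ) ≠ 0 := Nat.cast_ne_zero.mpr hn
  have h : (1 + y / n) ^ n ≤ Real.exp (y / n) ^ n :=
    pow_le_pow_left₀ (by positivity) (by linarith [Real.add_one_le_exp (y / n)]) n
  rw [← Real.exp_nat_mul, mul_div_cancel₀ y hn'] at h
  exact inv_anti₀ (by positivity) h

theorem le_exp_neg_of_le_pow {c y : ℝ} (n : ℕ) (hy : y ≤ n) (h : c ≤ (1 - y / n) ^ n) :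
    c ≤ Real.exp (-y) :=
  h.trans (Real.one_sub_div_pow_le_exp_neg hy)

theorem exp_neg_le_of_inv_pow_le {c y : ℝ} (n : ℕ) (hn : n ≠ 0) (hy : 0 ≤ y)
    (h : ((1 + y / n) ^ n)⁻¹ ≤ c) : Real.exp (-y) ≤ c :=
  (exp_neg_le_inv_one_add_div_pow hy hn).trans h

theorem conv_nonstandard_MTP2_gaussian_not_MTP2
    (g : ℝ × ℝ → ℝ)
    (hg : ∀ u : ℝ × ℝ,
      g u = Real.exp (-(1 / 2) * (5 * u.1 ^ 2 - 4 * u.1 * u.2 + u.2 ^ 2)))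
    (C : ℝ × ℝ → ℝ)
    (hC : ∀ a : ℝ × ℝ,
      C a = g (a - (2, 0)) + g (a - (0, 1)) + g (a - (2, 1)) + g (a - (0, 0))) :
    C ((0.98, 0.43) ⊓ (0.49, 0.7)) * C ((0.98, 0.43) ⊔ (0.49, 0.7))
        < C (0.98, 0.43) * C (0.49, 0.7) ∧
    ¬ (∀ p q : ℝ × ℝ, C p * C q ≤ C (p ⊓ q) * C (p ⊔ q)) := by
  have hexp (x y : ℝ) : C (x, y) =
      Real.exp (-((5 * (x - 2) ^ 2 - 4 * (x - 2) * y + y ^ 2) / 2)) +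
      Real.exp (-((5 * x ^ 2 - 4 * x * (y - 1) + (y - 1) ^ 2) / 2)) +
      Real.exp (-((5 * (x - 2) ^ 2 - 4 * (x - 2) * (y - 1) + (y - 1) ^ 2) / 2)) +
      Real.exp (-((5 * x ^ 2 - 4 * x * y + y ^ 2) / 2)) := by
    simp only [hC, hg, Prod.mk_sub_mk, sub_zero]
    congr 1 <;> [congr 1 <;> [congr 1; skip]; skip] <;> (congr 1; ring)
  have lower_left : 0.44 ≤ C (0.98, 0.43) := by
    rw [hexp]
    have e1 : 0.027 ≤ Real.exp (-3.57065) :=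
      le_exp_neg_of_le_pow 256 (by norm_num) (by norm_num)
    have e2 : 0.024 ≤ Real.exp (-3.68065) :=
      le_exp_neg_of_le_pow 256 (by norm_num) (by norm_num)
    have e3 : 0.199 ≤ Real.exp (-1.60065) :=
      le_exp_neg_of_le_pow 256 (by norm_num) (by norm_num)
    have e4 : 0.19 ≤ Real.exp (-1.65065) :=
      le_exp_neg_of_le_pow 256 (by norm_num) (by norm_num)
    norm_num at e1 e2 e3 e4 ⊢
    linarith
  have lower_right : 1.238 ≤ C (0.49, 0.7) := by
    rw [hexp]
    have e1 : 0.0002 ≤ Real.exp (-8.05925) :=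
      le_exp_neg_of_le_pow 256 (by norm_num) (by norm_num)
    have e2 : 0.387 ≤ Real.exp (-0.93925) :=
      le_exp_neg_of_le_pow 256 (by norm_num) (by norm_num)
    have e3 : 0.007 ≤ Real.exp (-4.83925) :=
      le_exp_neg_of_le_pow 256 (by norm_num) (by norm_num)
    have e4 : 0.844 ≤ Real.exp (-0.15925) :=
      le_exp_neg_of_le_pow 256 (by norm_num) (by norm_num)
    norm_num at e1 e2 e3 e4 ⊢
    linarith
  have upper_inf : C (0.49, 0.43) ≤ 1.055 := by
    rw [hexp]
    have e1 : Real.exp (-7.0913) ≤ 0.002 :=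
      exp_neg_le_of_inv_pow_le 256 (by norm_num) (by norm_num) (by norm_num)
    have e2 : Real.exp (-1.3213) ≤ 0.269 :=
      exp_neg_le_of_inv_pow_le 256 (by norm_num) (by norm_num) (by norm_num)
    have e3 : Real.exp (-4.1413) ≤ 0.017 :=
      exp_neg_le_of_inv_pow_le 256 (by norm_num) (by norm_num) (by norm_num)
    have e4 : Real.exp (-0.2713) ≤ 0.767 :=
      exp_neg_le_of_inv_pow_le 256 (by norm_num) (by norm_num) (by norm_num)
    norm_num at e1 e2 e3 e4 ⊢
    linarith
  have upper_sup : C (0.98, 0.7) ≤ 0.478 := by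
    rw [hexp]
    have e1 : Real.exp (-4.274) ≤ 0.015 :=
      exp_neg_le_of_inv_pow_le 256 (by norm_num) (by norm_num) (by norm_num)
    have e2 : Real.exp (-3.034) ≤ 0.049 :=
      exp_neg_le_of_inv_pow_le 256 (by norm_num) (by norm_num) (by norm_num)
    have e3 : Real.exp (-2.034) ≤ 0.132 :=
      exp_neg_le_of_inv_pow_le 256 (by norm_num) (by norm_num) (by norm_num)
    have e4 : Real.exp (-1.274) ≤ 0.282 :=
      exp_neg_le_of_inv_pow_le 256 (by norm_num) (by norm_num) (by norm_num)
    norm_num at e1 e2 e3 e4 ⊢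
    linarith
  have key : C ((0.98, 0.43) ⊓ (0.49, 0.7)) * C ((0.98, 0.43) ⊔ (0.49, 0.7))
      < C (0.98, 0.43) * C (0.49, 0.7) := by
    have hinf : ((0.98, 0.43) ⊓ (0.49, 0.7) : ℝ × ℝ) = (0.49, 0.43) := by
      ext <;> norm_num
    have hsup : ((0.98, 0.43) ⊔ (0.49, 0.7) : ℝ × ℝ) = (0.98, 0.7) := by
      ext <;> norm_num
    rw [hinf, hsup]
    have hpos : 0 ≤ C (0.98, 0.7) := by rw [hexp]; positivity
    calc C (0.49, 0.43) * C (0.98, 0.7) ≤ 1.055 * 0.478 :=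
          mul_le_mul upper_inf upper_sup hpos (by norm_num)
      _ < 0.44 * 1.238 := by norm_num
      _ ≤ C (0.98, 0.43) * C (0.49, 0.7) :=
          mul_le_mul lower_left lower_right (by norm_num) (le_trans (by norm_num) lower_left)
  exact ⟨key, fun h => (h _ _).not_gt key⟩
end

section
/- Let X ⊆ ℝ^d be a finite set with |X| = n. Then the min-max closure MM(X) of X is finite and |MM(X)| ≤ n^d. -/
/-- The min-max closure of a set `X ⊆ ℝ^d`: the smallest set containing `X` that is
closed under coordinatewise minimum `⊓` and coordinatewise maximum `⊔`. -/
def minMaxClosure {d : ℕ} (X : Set (Fin d → ℝ)) : Set (Fin d → ℝ) :=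
  ⋂₀ {S : Set (Fin d → ℝ) | X ⊆ S ∧ ∀ a ∈ S, ∀ b ∈ S, a ⊓ b ∈ S ∧ a ⊔ b ∈ S}

/-- The min-max closure of a finite set lies in the grid spanned by its coordinate projections. -/
lemma minMaxClosure_subset_piFinset_image {d : ℕ} (X : Finset (Fin d → ℝ)) :
    minMaxClosure (X : Set (Fin d → ℝ)) ⊆ Fintype.piFinset fun i => X.image fun x => x i := by
  refine Set.sInter_subset_of_mem ⟨fun x hx => ?_, fun a ha b hb => ?_⟩
  · exact Fintype.mem_piFinset.2 fun i => Finset.mem_image_of_mem _ hx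
  · simp only [SetLike.mem_coe, Fintype.mem_piFinset] at ha hb ⊢
    refine ⟨fun i => ?_, fun i => ?_⟩
    · rw [Pi.inf_apply]
      rcases min_choice (a i) (b i) with h | h
      · exact h.symm ▸ ha i
      · exact h.symm ▸ hb i
    · rw [Pi.sup_apply]
      rcases max_choice (a i) (b i) with h | h
      · exact h.symm ▸ ha i
      · exact h.symm ▸ hb i

theorem minMaxClosure_finite_card_le (d : ℕ) (X : Finset (Fin d → ℝ)) :
    (minMaxClosure (X : Set (Fin d → ℝ))).Finite ∧
    (minMaxClosure (X : Set (Fin d → ℝ))).ncard ≤ X.card ^ d := by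
  have hsub := minMaxClosure_subset_piFinset_image X
  refine ⟨(Finset.finite_toSet _).subset hsub, ?_⟩
  calc (minMaxClosure (X : Set (Fin d → ℝ))).ncard
      ≤ (Fintype.piFinset fun i => X.image fun x => x i).card := by
        simpa only [Set.ncard_coe_finset] using
          Set.ncard_le_ncard hsub (Finset.finite_toSet _)
    _ = ∏ i, (X.image fun x => x i).card := Fintype.card_piFinset _
    _ ≤ ∏ _i : Fin d, X.card := Finset.prod_le_prod' fun _ _ => Finset.card_image_le
    _ = X.card ^ d := by simp
end
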